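/- arXiv:2503.00827 — 2 statements merged into one kernel-verified Lean document; each statement's English description precedes it below -/
import Mathlib

section
/- Let E = X, let Y be a strictly convex Banach space, let Λ : X → Y be a bounded linear operator, let R be a Hilbert norm regularization satisfying the compactness condition and lower semicontinuity on X, with H₁ ∩ X a closed subspace of H₁ (i.e. H₁ ⊆ X), assume there exists σ̂ solving min{ R(σ) : σ ∈ X, ‖Λ̃−Λ(σ)‖_Y = δ_0 } with R(σ̂) < +∞, and let α ≥ 1, β ≥ 1. Then, with σ_{−1} = 0: (i) dist_{H₁}(σ_n, S) ≤ dist_{H₁}(σ_{n−1}, S) ≤ ‖σ̂‖_{H₁} for every n ≥ 0; (ii) if lim_n λ_n = +∞ then lim_n ‖Λ̃−Λ(σ_n)‖_Y = δ_0 = min{‖Λ̃−Λ(σ)‖_Y : σ ∈ X}; (iii) if lim_n λ_n = +∞ then lim_n σ_n = σ̂ in X, that is σ̂ = Σ_{n=0}^{+∞} u_n in X. -/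
open Filter Finset
open scoped ENNReal Topology

/-- If `w` has minimal norm on the initial part of a ray with direction `h`, then `⟪w, h⟫ ≥ 0`. -/
lemma inner_nonneg_of_norm_le_norm_add_smul {H : Type*} [NormedAddCommGroup H]
    [InnerProductSpace ℝ H] {w h : H}
    (hle : ∀ t : ℝ, 0 < t → t ≤ 1 → ‖w‖ ≤ ‖w + t • h‖) : 0 ≤ inner ℝ w h := by
  by_contra! hneg
  set a := inner ℝ w h with ha
  have hpos : 0 < -a + ‖h‖ ^ 2 := by nlinarith [sq_nonneg ‖h‖]
  set t := -a / (-a + ‖h‖ ^ 2) with ht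
  have ht0 : 0 < t := div_pos (by linarith) hpos
  have ht1 : t ≤ 1 := (div_le_one hpos).2 (by nlinarith [sq_nonneg ‖h‖])
  have hsq : ‖w‖ ^ 2 ≤ ‖w + t • h‖ ^ 2 := by
    gcongr
    exact hle t ht0 ht1
  rw [norm_add_sq_real, inner_smul_right, norm_smul, Real.norm_of_nonneg ht0.le, ← ha] at hsq
  have hmul : t * (-a + ‖h‖ ^ 2) = -a := div_mul_cancel₀ _ hpos.ne'
  have hprod : t * (a + t * a) < 0 := mul_neg_of_pos_of_neg ht0 (by nlinarith)
  nlinarith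

/-- In a strictly convex space, all minimizers of the residual of a linear problem have the same
image. -/
lemma eq_of_norm_sub_eq_of_forall_norm_sub_le {X Y : Type*} [NormedAddCommGroup X]
    [NormedSpace ℝ X] [NormedAddCommGroup Y] [NormedSpace ℝ Y] [StrictConvexSpace ℝ Y]
    (Λ : X →L[ℝ] Y) (y : Y) {a b : X} (ha : ∀ σ, ‖y - Λ a‖ ≤ ‖y - Λ σ‖)
    (hb : ‖y - Λ b‖ = ‖y - Λ a‖) : Λ b = Λ a := by
  have key : y - Λ b = y - Λ a := by
    refine eq_of_norm_eq_of_norm_add_eq hb (le_antisymm (norm_add_le _ _) ?_)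
    have hsum : (y - Λ b) + (y - Λ a) = (2 : ℝ) • (y - Λ ((1 / 2 : ℝ) • (b + a))) := by
      rw [map_smul, map_add]
      module
    have hmid := ha ((1 / 2 : ℝ) • (b + a))
    rw [hsum, norm_smul, Real.norm_of_nonneg zero_le_two]
    linarith
  simpa using key

/-- A Tikhonov minimizing step does not increase the distance to any minimizer of the residual. -/
lemma norm_sub_step_le {Y H : Type*} [NormedAddCommGroup Y] [NormedSpace ℝ Y]
    [NormedAddCommGroup H] [InnerProductSpace ℝ H] (A : H →ₗ[ℝ] Y) (y : Y) {α β l : ℝ}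
    (hα : 0 ≤ α) (hβ : 0 < β) (hl : 0 ≤ l) {s w q : H} (hq : ∀ v, ‖y - A q‖ ≤ ‖y - A v‖)
    (hmin : ∀ v, l * ‖y - A (s + w)‖ ^ α + ‖w‖ ^ β ≤ l * ‖y - A (s + v)‖ ^ α + ‖v‖ ^ β) :
    ‖q - (s + w)‖ ≤ ‖q - s‖ := by
  have hinner : 0 ≤ inner ℝ w (q - s - w) := by
    refine inner_nonneg_of_norm_le_norm_add_smul fun t ht0 ht1 => ?_
    have hres : ‖y - A (s + (w + t • (q - s - w)))‖ ≤ ‖y - A (s + w)‖ := by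
      have heq : y - A (s + (w + t • (q - s - w))) =
          (1 - t) • (y - A (s + w)) + t • (y - A q) := by
        simp only [map_add, map_smul, map_sub]
        module
      calc ‖y - A (s + (w + t • (q - s - w)))‖
          ≤ (1 - t) * ‖y - A (s + w)‖ + t * ‖y - A q‖ := by
            rw [heq]
            refine (norm_add_le _ _).trans_eq ?_
            rw [norm_smul, norm_smul, Real.norm_of_nonneg ht0.le,
              Real.norm_of_nonneg (sub_nonneg.2 ht1)]
        _ ≤ ‖y - A (s + w)‖ := by nlinarith [hq (s + w)]
    have hpow := mul_le_mul_of_nonneg_left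
      (Real.rpow_le_rpow (norm_nonneg _) hres hα) hl
    exact (Real.rpow_le_rpow_iff (norm_nonneg _) (norm_nonneg _) hβ).1
      (by linarith [hmin (w + t • (q - s - w))])
  have hexp : ‖q - s‖ ^ 2 = ‖w‖ ^ 2 + 2 * inner ℝ w (q - s - w) + ‖q - (s + w)‖ ^ 2 := by
    rw [← sub_sub, ← norm_add_sq_real, add_sub_cancel]
  exact (abs_le_of_sq_le_sq' (by nlinarith [sq_nonneg ‖w‖]) (norm_nonneg _)).2

/-- If `p` has minimal norm on the line through `p` and `v`, and `‖q - v‖ ≤ ‖q‖` for every point `q`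
of this line, then `v = p`. -/
lemma eq_of_forall_norm_sub_le {H : Type*} [NormedAddCommGroup H] [InnerProductSpace ℝ H]
    {p v : H} (hp : ∀ t : ℝ, ‖p‖ ≤ ‖p + t • (v - p)‖)
    (hv : ∀ t : ℝ, ‖p + t • (v - p) - v‖ ≤ ‖p + t • (v - p)‖) : v = p := by
  set k := v - p with hk
  have horth : inner ℝ p k = 0 := by
    refine le_antisymm ?_ (inner_nonneg_of_norm_le_norm_add_smul fun t _ _ => hp t)
    have hneg : 0 ≤ inner ℝ p (-k) :=
      inner_nonneg_of_norm_le_norm_add_smul fun t _ _ => by simpa using hp (-t)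
    rw [inner_neg_right] at hneg
    linarith
  have hbound : ∀ t : ℝ, (1 - 2 * t) * ‖k‖ ^ 2 ≤ ‖p‖ ^ 2 := by
    intro t
    have hsub : p + t • k - v = (t - 1) • k := by
      rw [hk]
      module
    have hsq : ‖p + t • k - v‖ ^ 2 ≤ ‖p + t • k‖ ^ 2 := by
      gcongr
      exact hv t
    rw [hsub, norm_add_sq_real, inner_smul_right, horth, norm_smul, norm_smul, mul_pow, mul_pow,
      Real.norm_eq_abs, Real.norm_eq_abs, sq_abs, sq_abs] at hsq
    nlinarith
  by_contra hne
  have hkpos : 0 < ‖k‖ ^ 2 := by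
    have := norm_pos_iff.2 (sub_ne_zero.2 hne)
    positivity
  have hcontra := hbound (-(‖p‖ ^ 2 / ‖k‖ ^ 2))
  have hdiv : ‖p‖ ^ 2 / ‖k‖ ^ 2 * ‖k‖ ^ 2 = ‖p‖ ^ 2 := div_mul_cancel₀ _ hkpos.ne'
  nlinarith [sq_nonneg ‖p‖]

/-- Corollary 3.4: the linear case with Hilbert norm regularization.
`E = X`, `Y` a strictly convex Banach space, `Λ : X → Y` bounded linear, `R` the Hilbert
norm regularization via the injective embedding `ι : H₁ → X` (so `H₁ ⊆ X`), with compact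
sublevel sets and lower semicontinuous, and `σ̂ = ι ŵ` solving
`min { R σ : ‖Λ̃ − Λ σ‖ = δ₀ }`.  Then (i) the `H₁`-distances of `σ_n` to `S` decrease
and are bounded by `‖σ̂‖_{H₁}`, and if `λ_n → ∞` then (ii) `‖Λ̃ − Λ σ_n‖ → δ₀` and
(iii) `σ_n → σ̂` in `X`, i.e. `σ̂ = ∑_{n} u_n` in `X`. -/
theorem statement11
    {X Y H1 : Type*} [NormedAddCommGroup X] [NormedSpace ℝ X] [CompleteSpace X]
    [NormedAddCommGroup Y] [NormedSpace ℝ Y] [CompleteSpace Y] [StrictConvexSpace ℝ Y]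
    [NormedAddCommGroup H1] [InnerProductSpace ℝ H1] [CompleteSpace H1]
    (Λ : X →L[ℝ] Y) (Λt : Y)
    (ι : H1 →ₗ[ℝ] X) (hι : Function.Injective ι) (hH1ne : ∃ w : H1, w ≠ 0)
    (R : X → ℝ≥0∞)
    (hR1 : ∀ w : H1, R (ι w) = ENNReal.ofReal ‖w‖)
    (hR2 : ∀ u : X, u ∉ Set.range ι → R u = ⊤)
    (hcomp : ∀ b : ℝ, IsCompact (closure {u : X | R u ≤ ENNReal.ofReal b}))
    (hlsc : LowerSemicontinuous R)
    (α β : ℝ) (hα : 1 ≤ α) (hβ : 1 ≤ β)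
    (what : H1)
    (hhatmin : ∀ σ : X, ‖Λt - Λ (ι what)‖ ≤ ‖Λt - Λ σ‖)
    (hhatopt : ∀ v : H1, ‖Λt - Λ (ι v)‖ = ‖Λt - Λ (ι what)‖ → ‖what‖ ≤ ‖v‖)
    (lam : ℕ → ℝ) (hlam : ∀ n, 0 < lam n)
    (u : ℕ → X) (w : ℕ → H1) (hw : ∀ n, u n = ι (w n))
    (hmin : ∀ n : ℕ, ∀ v : X,
      ENNReal.ofReal (lam n *
          ‖Λt - Λ ((∑ j ∈ Finset.range n, u j) + u n)‖ ^ α) + R (u n) ^ β ≤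
        ENNReal.ofReal (lam n *
          ‖Λt - Λ ((∑ j ∈ Finset.range n, u j) + v)‖ ^ α) + R v ^ β) :
    ∀ S : Set X,
      S = {σ : X | R σ < ⊤ ∧ ‖Λt - Λ σ‖ = ‖Λt - Λ (ι what)‖} →
      ((∀ n : ℕ,
          Metric.infDist (∑ j ∈ Finset.range (n + 1), w j) (ι ⁻¹' S) ≤
            Metric.infDist (∑ j ∈ Finset.range n, w j) (ι ⁻¹' S) ∧
          Metric.infDist (∑ j ∈ Finset.range n, w j) (ι ⁻¹' S) ≤ ‖what‖) ∧
        (Tendsto lam atTop atTop →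
          Tendsto (fun n : ℕ => ‖Λt - Λ (∑ j ∈ Finset.range (n + 1), u j)‖) atTop
            (𝓝 (‖Λt - Λ (ι what)‖)) ∧
          Tendsto (fun n : ℕ => ∑ j ∈ Finset.range (n + 1), u j) atTop
            (𝓝 (ι what)))) := by
  rintro S rfl
  set δ := ‖Λt - Λ (ι what)‖ with hδ
  set A : H1 →ₗ[ℝ] Y := Λ.toLinearMap ∘ₗ ι with hA
  set s : ℕ → H1 := fun n => ∑ j ∈ Finset.range n, w j with hs
  have hιs : ∀ n, ∑ j ∈ Finset.range n, u j = ι (s n) := fun n => by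
    simp only [hs, map_sum, hw]
  have hs_succ : ∀ n, s (n + 1) = s n + w n := fun n => Finset.sum_range_succ _ _
  have hmem : ∀ q : H1, q ∈ ι ⁻¹' {σ : X | R σ < ⊤ ∧ ‖Λt - Λ σ‖ = δ} ↔ ‖Λt - A q‖ = δ := by
    intro q
    simp [hR1, hA]
  have hreal : ∀ n v, lam n * ‖Λt - A (s n + w n)‖ ^ α + ‖w n‖ ^ β ≤
      lam n * ‖Λt - A (s n + v)‖ ^ α + ‖v‖ ^ β := by
    intro n v
    have h := hmin n (ι v)
    have hl := (hlam n).le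
    rw [hιs, hw, ← map_add, ← map_add, hR1, hR1,
      ENNReal.ofReal_rpow_of_nonneg (norm_nonneg _) (by linarith),
      ENNReal.ofReal_rpow_of_nonneg (norm_nonneg _) (by linarith),
      ← ENNReal.ofReal_add (by positivity) (by positivity),
      ← ENNReal.ofReal_add (by positivity) (by positivity),
      ENNReal.ofReal_le_ofReal_iff (by positivity)] at h
    exact h
  have hstep : ∀ q, ‖Λt - A q‖ = δ → ∀ n, ‖q - s (n + 1)‖ ≤ ‖q - s n‖ := by
    intro q hq n
    rw [hs_succ]
    exact norm_sub_step_le A Λt (by linarith) (by linarith) (hlam n).le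
      (fun v => hq.trans_le (hhatmin (ι v))) (hreal n)
  have hdist : ∀ q, ‖Λt - A q‖ = δ → ∀ n, ‖q - s n‖ ≤ ‖q‖ := by
    intro q hq n
    have h := antitone_nat_of_succ_le (f := fun m => ‖q - s m‖) (hstep q hq) (Nat.zero_le n)
    simpa [hs] using h
  have hwhat : ‖Λt - A what‖ = δ := rfl
  refine ⟨fun n => ⟨?_, ?_⟩, fun hlim => ?_⟩
  · refine (Metric.le_infDist ⟨what, (hmem what).2 hwhat⟩).2 fun q hq => ?_
    refine (Metric.infDist_le_dist_of_mem hq).trans ?_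
    rw [dist_comm, dist_eq_norm, dist_comm, dist_eq_norm]
    exact hstep q ((hmem q).1 hq) n
  · refine (Metric.infDist_le_dist_of_mem ((hmem what).2 hwhat)).trans ?_
    rw [dist_comm, dist_eq_norm]
    exact hdist what hwhat n
  have hres : Tendsto (fun n => ‖Λt - Λ (ι (s (n + 1)))‖) atTop (𝓝 δ) := by
    have hupper : Tendsto (fun n => δ ^ α + ‖what‖ ^ β / lam n) atTop (𝓝 (δ ^ α)) := by
      simpa using tendsto_const_nhds.add (hlim.const_div_atTop (‖what‖ ^ β))
    have hpow : Tendsto (fun n => ‖Λt - Λ (ι (s (n + 1)))‖ ^ α) atTop (𝓝 (δ ^ α)) := by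
      refine tendsto_of_tendsto_of_tendsto_of_le_of_le tendsto_const_nhds hupper
        (fun n => Real.rpow_le_rpow (norm_nonneg _) (hhatmin _) (by linarith)) fun n => ?_
      have h := hreal n (what - s n)
      rw [add_sub_cancel, hwhat, ← hs_succ] at h
      have hpos := hlam n
      have hβ' : ‖what - s n‖ ^ β ≤ ‖what‖ ^ β :=
        Real.rpow_le_rpow (norm_nonneg _) (hdist what hwhat n) (by linarith)
      have hw0 : 0 ≤ ‖w n‖ ^ β := by positivity
      have heq : δ ^ α + ‖what‖ ^ β / lam n = (lam n * δ ^ α + ‖what‖ ^ β) / lam n := by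
        field_simp
      change ‖Λt - A (s (n + 1))‖ ^ α ≤ δ ^ α + ‖what‖ ^ β / lam n
      rw [heq, le_div_iff₀ hpos]
      linarith
    have hroot := hpow.rpow_const (p := α⁻¹) (Or.inr (by positivity))
    have hα0 : α ≠ 0 := by linarith
    simpa only [Real.rpow_rpow_inv (norm_nonneg _) hα0, hδ] using hroot
  simp only [hιs]
  refine ⟨hres, ?_⟩
  refine (hcomp (2 * ‖what‖)).tendsto_nhds_of_unique_mapClusterPt
    (Eventually.of_forall fun n => subset_closure ?_) fun x _ hx => ?_
  · change R (ι (s (n + 1))) ≤ _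
    rw [hR1]
    refine ENNReal.ofReal_le_ofReal ?_
    have h1 := hdist what hwhat (n + 1)
    have h2 := norm_le_norm_add_norm_sub what (s (n + 1))
    linarith
  have hclosed : ∀ q, ‖Λt - A q‖ = δ → R (ι q - x) ≤ ENNReal.ofReal ‖q‖ := by
    intro q hq
    have hcl : IsClosed {y : X | R (ι q - y) ≤ ENNReal.ofReal ‖q‖} :=
      (hlsc.isClosed_preimage _).preimage (continuous_const.sub continuous_id)
    refine hcl.mem_of_mapClusterPt hx (Eventually.of_forall fun n => ?_)
    change R (ι q - ι (s (n + 1))) ≤ _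
    rw [← map_sub, hR1]
    exact ENNReal.ofReal_le_ofReal (hdist q hq _)
  obtain ⟨v, rfl⟩ : ∃ v, ι v = x := by
    have hrange : ι what - x ∈ Set.range ι := by
      by_contra hnot
      have h := hclosed what hwhat
      rw [hR2 _ hnot] at h
      exact ENNReal.ofReal_ne_top (top_le_iff.1 h)
    obtain ⟨z, hz⟩ := hrange
    exact ⟨what - z, by rw [map_sub, hz, sub_sub_cancel]⟩
  have hvδ : ‖Λt - Λ (ι v)‖ = δ := by
    have hcont : Continuous fun y : X => ‖Λt - Λ y‖ := by fun_prop
    have hcl := hx.continuousAt_comp hcont.continuousAt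
    exact eq_of_nhds_neBot (hcl.neBot.mono (inf_le_inf_left _ hres))
  have hAv : A v = A what := eq_of_norm_sub_eq_of_forall_norm_sub_le Λ Λt hhatmin hvδ
  have hline : ∀ t : ℝ, ‖Λt - A (what + t • (v - what))‖ = δ := fun t => by
    rw [map_add, map_smul, map_sub, hAv, sub_self, smul_zero, add_zero, hwhat]
  rw [eq_of_forall_norm_sub_le (fun t => hhatopt _ (hline t)) fun t => ?_]
  have h := hclosed _ (hline t)
  rwa [← map_sub, hR1, ENNReal.ofReal_le_ofReal_iff (norm_nonneg _)] at h
end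

section
/- For every M ≥ 2 and α_0 > 0, if k = 5 there exist constants c_0 > 0, b > 0 and 0 < δ < 1/k such that, for Λ̃ = Λ(e_1), the multiscale sequence {σ_n}_{n≥0} (with parameters λ_n = α_0 M^n, fidelity exponent α = 2 and regularization exponent β = 1) coincides with the explicit sequence σ_n = Σ_{j=0}^n u_j where u_j = (b/(j+2)) e_{j+2}; in particular each u_n = (b/(n+2)) e_{n+2} is the unique minimizer of λ_n‖Λ(e_1) − Λ(σ_{n−1} + u)‖_{ℓ²}² + R(u) over u ∈ ℓ¹, and ‖σ_n‖_{ℓ¹} → +∞. -/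
open Filter Finset
open scoped ENNReal Topology

noncomputable section

def Acoef (k : ℕ) (δ : ℝ) (i : ℕ) : ℝ :=
  if i = 1 then 1 - k * δ else if i = k then 2 * δ else δ

def Ccoef (k : ℕ) (δ : ℝ) (m : ℕ) : ℝ := ∑ i ∈ Finset.Icc 1 m, Acoef k δ i

def eta (c0 M : ℝ) (j : ℕ) : ℝ := Real.sqrt (c0 / M ^ j)

def mu (c0 M δ : ℝ) (j : ℕ) : ℝ := -δ * eta c0 M j

/-- The `m`-th coordinate (paper indices) of `Λ e_j`. -/
def lamCoord (c0 M δ b : ℝ) (k j m : ℕ) : ℝ :=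
  if j = 1 then
    (if 1 ≤ m ∧ m ≤ k then Ccoef k δ m * eta c0 M m
      else if k + 1 ≤ m then eta c0 M m else 0) +
      (if m = k then mu c0 M δ k else 0)
  else
    ((j : ℝ) / b) *
      ((if j - 1 ≤ m ∧ m ≤ j + k - 2 then Acoef k δ (m + 2 - j) * eta c0 M m else 0) +
        (if m = j + k - 2 then mu c0 M δ m else 0) -
        (if m = j + k - 1 then mu c0 M δ m else 0))

def lpSpec (c0 M δ b : ℝ) (k : ℕ)
    (Λ : lp (fun _ : ℕ => ℝ) 1 →L[ℝ] lp (fun _ : ℕ => ℝ) 2) : Prop :=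
  ∀ j m : ℕ, (Λ (lp.single 1 j 1)) m = lamCoord c0 M δ b k (j + 1) (m + 1)

/-- The Banach norm regularization `R(γ) = ‖γ‖_F = ∑_{n≥1} n|γ_n|` (paper indices),
with value `+∞` when `γ ∉ F`. -/
def Rl1 (γ : lp (fun _ : ℕ => ℝ) 1) : ℝ≥0∞ :=
  ∑' n : ℕ, ENNReal.ofReal (((n : ℝ) + 1) * |γ n|)

/-- `u_j = (b/(j+2)) e_{j+2}` (paper index `j + 2` is the Lean index `j + 1`). -/
def useq (b : ℝ) (j : ℕ) : lp (fun _ : ℕ => ℝ) 1 :=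
  (b / ((j : ℝ) + 2)) • lp.single 1 (j + 1) 1

/-- The functional of the `n`-th step of the multiscale procedure (with `Λ̃ = Λ e₁`,
`λ_n = α₀ M^n`, fidelity exponent `2` and regularization exponent `1`), at increment `v`,
based at `σ_{n−1} = ∑_{j<n} u_j`. -/
def Jfun (α0 M b : ℝ) (Λ : lp (fun _ : ℕ => ℝ) 1 →L[ℝ] lp (fun _ : ℕ => ℝ) 2)
    (n : ℕ) (v : lp (fun _ : ℕ => ℝ) 1) : ℝ≥0∞ :=
  ENNReal.ofReal (α0 * M ^ n *
      ‖Λ (lp.single 1 0 1) - Λ ((∑ j ∈ Finset.range n, useq b j) + v)‖ ^ 2) +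
    Rl1 v

/-- Coefficients of the rescaled images `Λ u_i` relative to `η`. -/
def stepProfile : ℕ → ℝ
  | 0 => 0
  | 1 => 1 / 12
  | 2 => 11 / 60
  | 3 => 11 / 60
  | 4 => 11 / 60
  | 5 => 11 / 60
  | 6 => 11 / 60
  | _ + 7 => 0

/-- Coefficients of the residuals relative to `η`: the partial sums of `stepProfile`. -/
def resProfile : ℕ → ℝ
  | 0 => 0
  | 1 => 5 / 60
  | 2 => 16 / 60
  | 3 => 27 / 60
  | 4 => 38 / 60
  | 5 => 49 / 60
  | _ + 6 => 1

theorem stepProfile_of_seven_le {t : ℕ} (ht : 7 ≤ t) : stepProfile t = 0 := by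
  obtain ⟨s, rfl⟩ := Nat.exists_eq_add_of_le' ht
  rfl

theorem stepProfile_nonneg (t : ℕ) : 0 ≤ stepProfile t := by
  rcases t with _ | _ | _ | _ | _ | _ | _ | t <;> norm_num [stepProfile]

theorem resProfile_nonneg (t : ℕ) : 0 ≤ resProfile t := by
  rcases t with _ | _ | _ | _ | _ | _ | t <;> norm_num [resProfile]

theorem resProfile_le_one (t : ℕ) : resProfile t ≤ 1 := by
  rcases t with _ | _ | _ | _ | _ | _ | t <;> norm_num [resProfile]

theorem resProfile_succ (t : ℕ) : resProfile (t + 1) = resProfile t + stepProfile (t + 1) := by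
  rcases t with _ | _ | _ | _ | _ | _ | t <;> norm_num [resProfile, stepProfile]

theorem resProfile_sub_succ (m n : ℕ) :
    resProfile (m + 1 - n) = resProfile (m - n) + stepProfile (m + 1 - n) := by
  rcases le_or_gt n m with h | h
  · rw [Nat.sub_add_comm h, resProfile_succ]
  · rw [Nat.sub_eq_zero_of_le (by omega : m + 1 ≤ n), Nat.sub_eq_zero_of_le h.le]
    simp [resProfile, stepProfile]

theorem lamCoord_one (c0 M b : ℝ) (m : ℕ) :
    lamCoord c0 M (11 / 60) b 5 1 (m + 1) = resProfile (m + 1) * eta c0 M (m + 1) := by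
  rcases m with _ | _ | _ | _ | _ | m
  all_goals
    simp [lamCoord, Ccoef, Acoef, mu, resProfile, Finset.sum_Icc_succ_top]
  all_goals first | (left; norm_num) | ring

theorem lamCoord_add_two (c0 M b : ℝ) (i m : ℕ) :
    lamCoord c0 M (11 / 60) b 5 (i + 2) (m + 1) =
      (i + 2) / b * (stepProfile (m + 1 - i) * eta c0 M (m + 1)) := by
  rcases lt_or_ge m i with h | h
  · rw [Nat.sub_eq_zero_of_le (by omega : m + 1 ≤ i)]
    have h1 : ¬ (i + 2 - 1 ≤ m + 1) := by omega
    have h2 : ¬ (m + 1 = i + 2 + 5 - 2) := by omega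
    have h3 : ¬ (m + 1 = i + 2 + 5 - 1) := by omega
    have h4 : i + 2 ≠ 1 := by omega
    simp only [lamCoord, stepProfile, h1, h2, h3, h4, false_and, if_false]
    simp
  · obtain ⟨d, rfl⟩ := Nat.exists_eq_add_of_le h
    have e1 : i + d + 1 - i = d + 1 := by omega
    have e2 : i + d + 1 + 2 - (i + 2) = d + 1 := by omega
    have e3 : i + 2 - 1 ≤ i + d + 1 := by omega
    have e4 : (i + d + 1 ≤ i + 2 + 5 - 2) ↔ d ≤ 4 := by omega
    have e5 : (i + d + 1 = i + 2 + 5 - 2) ↔ d = 4 := by omega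
    have e6 : (i + d + 1 = i + 2 + 5 - 1) ↔ d = 5 := by omega
    have e7 : i + 2 ≠ 1 := by omega
    simp only [lamCoord, e1, e2, e3, e4, e5, e6, e7, if_false, true_and]
    rcases d with _ | _ | _ | _ | _ | _ | d
    all_goals
      simp [Acoef, mu, stepProfile]
    all_goals try ring_nf
    all_goals try simp

/-- The correlation of a residual with the image of the `s`-th next basis vector. -/
def forwardCorr (x : ℝ) (s : ℕ) : ℝ :=
  ∑ l ∈ Finset.range 6, resProfile (s + l) * stepProfile (l + 1) * x ^ (s + l + 1)

theorem forwardCorr_zero_pos {x : ℝ} (hx : 0 < x) : 0 < forwardCorr x 0 := by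
  simp only [forwardCorr, Finset.sum_range_succ, Finset.sum_range_zero, resProfile, stepProfile,
    zero_add]
  positivity

theorem forwardCorr_succ_lt {x : ℝ} (hx : 0 < x) (hx2 : x ≤ 1 / 2) (s : ℕ) :
    forwardCorr x (s + 1) < forwardCorr x s := by
  have h5 : x ^ 5 ≤ 1 / 32 := by
    calc x ^ 5 ≤ (1 / 2) ^ 5 := by gcongr
      _ = 1 / 32 := by norm_num
  have hrec : forwardCorr x s - forwardCorr x (s + 1) = x ^ (s + 1) *
      (1 / 12 * (resProfile s - resProfile (s + 1) * x) +
        11 / 60 * x * (resProfile (s + 1) - x ^ 5 * resProfile (s + 6))) := by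
    simp only [forwardCorr, Finset.sum_range_succ, Finset.sum_range_zero, stepProfile,
      zero_add, add_zero, add_assoc]
    norm_num
    ring
  have hpos : 0 < 1 / 12 * (resProfile s - resProfile (s + 1) * x) +
        11 / 60 * x * (resProfile (s + 1) - x ^ 5 * resProfile (s + 6)) := by
    have h6 : resProfile (s + 6) = 1 := rfl
    rw [h6]
    rcases s with _ | s
    · simp only [resProfile]
      nlinarith
    · have h1 : 16 / 60 ≤ resProfile (s + 1 + 1) := by
        rcases s with _ | _ | _ | _ | s <;> norm_num [resProfile]
      have h0 := resProfile_nonneg (s + 1)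
      nlinarith
  have := mul_pos (pow_pos hx (s + 1)) hpos
  linarith

theorem forwardCorr_lt_zero {x : ℝ} (hx : 0 < x) (hx2 : x ≤ 1 / 2) {s : ℕ} (hs : 0 < s) :
    forwardCorr x s < forwardCorr x 0 :=
  strictAnti_nat_of_succ_lt (forwardCorr_succ_lt hx hx2) hs

/-- The correlation of a residual with the image of the `d`-th previous basis vector. -/
def backwardCorr (x : ℝ) (d : ℕ) : ℝ :=
  ∑ t ∈ Finset.range 6, resProfile t * stepProfile (t + d + 1) * x ^ (t + 1)

theorem backwardCorr_lt {x : ℝ} (hx : 0 < x) {d : ℕ} (hd : 0 < d) :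
    backwardCorr x d < forwardCorr x 0 := by
  obtain ⟨d, rfl⟩ := Nat.exists_eq_succ_of_ne_zero hd.ne'
  simp only [backwardCorr, forwardCorr, zero_add]
  refine Finset.sum_lt_sum (fun t ht => ?_) ⟨5, by simp, ?_⟩
  · rw [Finset.mem_range] at ht
    rcases t with _ | t
    · simp [resProfile]
    · have hle : stepProfile (t + 1 + d.succ + 1) ≤ stepProfile (t + 1 + 1) := by
        have h1 : stepProfile (t + 1 + 1) = 11 / 60 := by
          have : t < 5 := by omega
          interval_cases t <;> rfl
        rw [h1]
        generalize t + 1 + d.succ + 1 = q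
        rcases q with _ | _ | _ | _ | _ | _ | _ | q <;> norm_num [stepProfile]
      have := resProfile_nonneg (t + 1)
      gcongr
  · rw [stepProfile_of_seven_le (by omega)]
    simp only [resProfile, stepProfile]
    simp only [mul_zero, zero_mul]
    positivity

theorem hasSum_clm_single (φ : lp (fun _ : ℕ => ℝ) 1 →L[ℝ] ℝ) (v : lp (fun _ : ℕ => ℝ) 1) :
    HasSum (fun j => φ (lp.single 1 j 1) * v j) (φ v) := by
  have h := (lp.hasSum_single (by simp) v).mapL φ
  refine h.congr_fun fun j => ?_
  have : lp.single 1 j (v j) = v j • (lp.single 1 j 1 : lp (fun _ : ℕ => ℝ) 1) := by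
    rw [← lp.single_smul, smul_eq_mul, mul_one]
  rw [this, map_smul, smul_eq_mul, mul_comm]

theorem summable_of_Rl1_ne_top {v : lp (fun _ : ℕ => ℝ) 1} (hv : Rl1 v ≠ ⊤) :
    Summable fun j : ℕ => ((j : ℝ) + 1) * |v j| := by
  have h := ENNReal.summable_toReal hv
  refine h.congr fun j => ?_
  rw [ENNReal.toReal_ofReal (by positivity)]

theorem toReal_Rl1 (v : lp (fun _ : ℕ => ℝ) 1) :
    (Rl1 v).toReal = ∑' j : ℕ, ((j : ℝ) + 1) * |v j| := by
  rw [Rl1, ENNReal.tsum_toReal_eq fun _ => ENNReal.ofReal_ne_top]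
  exact tsum_congr fun j => ENNReal.toReal_ofReal (by positivity)

theorem Rl1_useq {b : ℝ} (hb : 0 < b) (n : ℕ) : Rl1 (useq b n) = ENNReal.ofReal b := by
  rw [Rl1, tsum_eq_single (n + 1)]
  · have : useq b n (n + 1) = b / (n + 2) := by simp [useq]
    rw [this, abs_of_pos (by positivity)]
    push_cast
    congr 1
    field_simp
    ring
  · intro j hj
    have : useq b n j = 0 := by simp [useq, hj]
    simp [this]

section Dual

variable {φ : lp (fun _ : ℕ => ℝ) 1 →L[ℝ] ℝ} {v : lp (fun _ : ℕ => ℝ) 1}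

theorem mul_coord_le (hφ0 : ∀ j, 0 ≤ φ (lp.single 1 j 1))
    (hφ : ∀ j : ℕ, φ (lp.single 1 j 1) ≤ j + 1) (j : ℕ) :
    φ (lp.single 1 j 1) * v j ≤ ((j : ℝ) + 1) * |v j| :=
  (mul_le_mul_of_nonneg_left (le_abs_self _) (hφ0 j)).trans
    (mul_le_mul_of_nonneg_right (hφ j) (abs_nonneg _))

theorem clm_le_toReal_Rl1 (hφ0 : ∀ j, 0 ≤ φ (lp.single 1 j 1))
    (hφ : ∀ j : ℕ, φ (lp.single 1 j 1) ≤ j + 1) (hv : Rl1 v ≠ ⊤) : φ v ≤ (Rl1 v).toReal := by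
  rw [toReal_Rl1]
  exact hasSum_le (mul_coord_le hφ0 hφ) (hasSum_clm_single φ v) (summable_of_Rl1_ne_top hv).hasSum

theorem coord_eq_zero_of_toReal_Rl1_le (hφ0 : ∀ j, 0 ≤ φ (lp.single 1 j 1))
    (hφ : ∀ j : ℕ, φ (lp.single 1 j 1) ≤ j + 1) (hv : Rl1 v ≠ ⊤)
    (hle : (Rl1 v).toReal ≤ φ v) {j : ℕ} (hj : φ (lp.single 1 j 1) < j + 1) : v j = 0 := by
  by_contra hne
  rw [toReal_Rl1] at hle
  refine hle.not_gt (hasSum_lt (mul_coord_le hφ0 hφ) (i := j) ?_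
    (hasSum_clm_single φ v) (summable_of_Rl1_ne_top hv).hasSum)
  exact (mul_le_mul_of_nonneg_left (le_abs_self _) (hφ0 j)).trans_lt
    (mul_lt_mul_of_pos_right hj (abs_pos.mpr hne))

end Dual

theorem eta_mul_self {c0 M : ℝ} (hc : 0 ≤ c0) (hM : 0 ≤ M) (j : ℕ) :
    eta c0 M j * eta c0 M j = c0 / M ^ j :=
  Real.mul_self_sqrt (by positivity)

theorem hasSum_inner_eta {α0 M : ℝ} (hα0 : 0 < α0) (hM : 0 < M) (n : ℕ) {a c : ℕ → ℝ}
    {f g : lp (fun _ : ℕ => ℝ) 2} (hf : ∀ m, f m = a m * eta (1 / (2 * α0)) M (m + 1))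
    (hg : ∀ m, g m = c m * eta (1 / (2 * α0)) M (m + 1)) :
    HasSum (fun m => a m * c m * (M ^ n * M⁻¹ ^ (m + 1)))
      (2 * (α0 * M ^ n) * inner ℝ f g) := by
  refine ((lp.hasSum_inner (𝕜 := ℝ) f g).mul_left (2 * (α0 * M ^ n))).congr_fun fun m => ?_
  rw [hf, hg, real_inner_eq_re_inner]
  have h := eta_mul_self (c0 := 1 / (2 * α0)) (M := M) (by positivity) hM.le (m + 1)
  have : 2 * α0 * (eta (1 / (2 * α0)) M (m + 1) * eta (1 / (2 * α0)) M (m + 1)) =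
      M⁻¹ ^ (m + 1) := by
    rw [h, inv_pow]
    field_simp
  rw [← this]
  simp
  ring

theorem tsum_forward {M : ℝ} (hM : 0 < M) (n s : ℕ) :
    ∑' m, resProfile (m - n) * stepProfile (m + 1 - (n + s)) * (M ^ n * M⁻¹ ^ (m + 1)) =
      forwardCorr M⁻¹ s := by
  rw [tsum_eq_sum (s := Finset.Ico (n + s) (n + s + 6)), Finset.sum_Ico_eq_sum_range, forwardCorr,
    Nat.add_sub_cancel_left]
  · refine Finset.sum_congr rfl fun l _ => ?_
    rw [show n + s + l - n = s + l by omega, show n + s + l + 1 - (n + s) = l + 1 by omega,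
      show n + s + l + 1 = n + (s + l + 1) by omega, pow_add M⁻¹ n, ← mul_assoc (M ^ n),
      ← mul_pow, mul_inv_cancel₀ hM.ne', one_pow, one_mul]
  · intro m hm
    rw [Finset.mem_Ico] at hm
    rcases lt_or_ge m (n + s) with h | h
    · rw [Nat.sub_eq_zero_of_le (by omega : m + 1 ≤ n + s)]
      simp [stepProfile]
    · rw [stepProfile_of_seven_le (by omega)]
      simp

theorem tsum_backward {M : ℝ} (hM : 0 < M) (i d : ℕ) :
    ∑' m, resProfile (m - (i + d)) * stepProfile (m + 1 - i) * (M ^ (i + d) * M⁻¹ ^ (m + 1)) =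
      backwardCorr M⁻¹ d := by
  rw [tsum_eq_sum (s := Finset.Ico (i + d) (i + d + 6)), Finset.sum_Ico_eq_sum_range, backwardCorr,
    Nat.add_sub_cancel_left]
  · refine Finset.sum_congr rfl fun t _ => ?_
    rw [show i + d + t - (i + d) = t by omega, show i + d + t + 1 - i = t + d + 1 by omega,
      show i + d + t + 1 = (i + d) + (t + 1) by omega, pow_add M⁻¹ (i + d),
      ← mul_assoc (M ^ (i + d)), ← mul_pow, mul_inv_cancel₀ hM.ne', one_pow, one_mul]
  · intro m hm
    rw [Finset.mem_Ico] at hm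
    rcases lt_or_ge m (i + d) with h | h
    · rw [Nat.sub_eq_zero_of_le h.le]
      simp [resProfile]
    · rw [stepProfile_of_seven_le (by omega)]
      simp

section Operator

variable {M α0 b : ℝ} {Λ : lp (fun _ : ℕ => ℝ) 1 →L[ℝ] lp (fun _ : ℕ => ℝ) 2}

theorem map_single_zero_coord {c0 : ℝ} (hΛ : lpSpec c0 M (11 / 60) b 5 Λ) (m : ℕ) :
    Λ (lp.single 1 0 1) m = resProfile (m + 1) * eta c0 M (m + 1) := by
  rw [hΛ, lamCoord_one]

theorem map_single_succ_coord {c0 : ℝ} (hΛ : lpSpec c0 M (11 / 60) b 5 Λ) (i m : ℕ) :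
    Λ (lp.single 1 (i + 1) 1) m =
      (i + 2) / b * (stepProfile (m + 1 - i) * eta c0 M (m + 1)) := by
  rw [hΛ, lamCoord_add_two]

theorem residual_coord {c0 : ℝ} (hb : 0 < b) (hΛ : lpSpec c0 M (11 / 60) b 5 Λ) (n m : ℕ) :
    (Λ (lp.single 1 0 1) - Λ (∑ j ∈ Finset.range n, useq b j)) m =
      resProfile (m + 1 - n) * eta c0 M (m + 1) := by
  induction n with
  | zero => simpa using map_single_zero_coord hΛ m
  | succ n ih =>
    have hstep : Λ (useq b n) m = stepProfile (m + 1 - n) * eta c0 M (m + 1) := by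
      rw [useq, map_smul, lp.coeFn_smul, Pi.smul_apply, map_single_succ_coord hΛ, smul_eq_mul]
      field_simp
    rw [Finset.sum_range_succ, map_add, ← sub_sub, lp.coeFn_sub, Pi.sub_apply, ih, hstep,
      resProfile_sub_succ, Nat.add_sub_add_right]
    ring

/-- The functional `v ↦ 2 λ_n ⟪r, Λ v⟫` for the residual `r` after step `n`. -/
def dualCert (M α0 b : ℝ) (Λ : lp (fun _ : ℕ => ℝ) 1 →L[ℝ] lp (fun _ : ℕ => ℝ) 2) (n : ℕ) :
    lp (fun _ : ℕ => ℝ) 1 →L[ℝ] ℝ :=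
  (2 * (α0 * M ^ n)) •
    (innerSL ℝ (Λ (lp.single 1 0 1) - Λ (∑ j ∈ Finset.range (n + 1), useq b j))).comp Λ

theorem dualCert_apply (n : ℕ) (v : lp (fun _ : ℕ => ℝ) 1) :
    dualCert M α0 b Λ n v = 2 * (α0 * M ^ n) *
      inner ℝ (Λ (lp.single 1 0 1) - Λ (∑ j ∈ Finset.range (n + 1), useq b j)) (Λ v) :=
  rfl

theorem hasSum_dualCert (hα0 : 0 < α0) (hM : 0 < M) (hb : 0 < b)
    (hΛ : lpSpec (1 / (2 * α0)) M (11 / 60) b 5 Λ) (n : ℕ) {v : lp (fun _ : ℕ => ℝ) 1}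
    {c : ℕ → ℝ} (hv : ∀ m, Λ v m = c m * eta (1 / (2 * α0)) M (m + 1)) :
    HasSum (fun m => resProfile (m - n) * c m * (M ^ n * M⁻¹ ^ (m + 1)))
      (dualCert M α0 b Λ n v) :=
  hasSum_inner_eta hα0 hM n
    (fun m => by rw [residual_coord hb hΛ, Nat.add_sub_add_right]) hv

theorem dualCert_single_zero (hα0 : 0 < α0) (hM : 2 ≤ M) (hb : 0 < b)
    (hΛ : lpSpec (1 / (2 * α0)) M (11 / 60) b 5 Λ) (n : ℕ) :
    0 ≤ dualCert M α0 b Λ n (lp.single 1 0 1) ∧ dualCert M α0 b Λ n (lp.single 1 0 1) < 1 := by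
  have hM0 : 0 < M := by linarith
  have hx : M⁻¹ ≤ 1 / 2 := by
    rw [one_div]
    exact inv_anti₀ two_pos hM
  have h := hasSum_dualCert hα0 hM0 hb hΛ n (map_single_zero_coord hΛ)
  refine ⟨h.nonneg fun m => mul_nonneg (mul_nonneg (resProfile_nonneg _) (resProfile_nonneg _))
    (by positivity), ?_⟩
  have h' := (hasSum_nat_add_iff' (n + 1)).mpr h
  rw [Finset.sum_eq_zero, sub_zero] at h'
  · have hgeom : HasSum (fun t : ℕ => (1 / 2 : ℝ) ^ t * (1 / 4)) (2 * (1 / 4)) :=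
      hasSum_geometric_two.mul_right _
    refine (hasSum_le (fun t => ?_) h' hgeom).trans_lt (by norm_num)
    calc _ ≤ 1 * 1 * (M ^ n * M⁻¹ ^ (t + (n + 1) + 1)) := by
          have := resProfile_nonneg (t + (n + 1) + 1)
          gcongr <;> exact resProfile_le_one _
      _ = M⁻¹ ^ (t + 2) := by
          rw [show t + (n + 1) + 1 = n + (t + 2) by omega, pow_add M⁻¹ n, ← mul_assoc (M ^ n),
            ← mul_pow, mul_inv_cancel₀ hM0.ne']
          simp
      _ ≤ (1 / 2) ^ (t + 2) := by gcongr
      _ = (1 / 2) ^ t * (1 / 4) := by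
          rw [pow_add]
          norm_num
  · intro m hm
    rw [Finset.mem_range] at hm
    rw [Nat.sub_eq_zero_of_le (by omega : m ≤ n)]
    simp [resProfile]

theorem dualCert_single_succ (hα0 : 0 < α0) (hM : 0 < M) (hb : 0 < b)
    (hΛ : lpSpec (1 / (2 * α0)) M (11 / 60) b 5 Λ) (n i : ℕ) :
    dualCert M α0 b Λ n (lp.single 1 (i + 1) 1) = (i + 2) / b *
      ∑' m, resProfile (m - n) * stepProfile (m + 1 - i) * (M ^ n * M⁻¹ ^ (m + 1)) := by
  rw [← tsum_mul_left, ← (hasSum_dualCert hα0 hM hb hΛ n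
    (c := fun m => (i + 2) / b * stepProfile (m + 1 - i)) fun m => ?_).tsum_eq]
  · exact tsum_congr fun m => by ring
  · rw [map_single_succ_coord hΛ]
    ring

theorem tsum_corr_nonneg (hM : 0 < M) (n i : ℕ) :
    0 ≤ ∑' m, resProfile (m - n) * stepProfile (m + 1 - i) * (M ^ n * M⁻¹ ^ (m + 1)) :=
  tsum_nonneg fun m => mul_nonneg (mul_nonneg (resProfile_nonneg _) (stepProfile_nonneg _))
    (by positivity)

theorem tsum_corr_lt (hM : 2 ≤ M) {n i : ℕ} (hi : i ≠ n) :
    ∑' m, resProfile (m - n) * stepProfile (m + 1 - i) * (M ^ n * M⁻¹ ^ (m + 1)) <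
      forwardCorr M⁻¹ 0 := by
  have hM0 : 0 < M := by linarith
  have hx : M⁻¹ ≤ 1 / 2 := by
    rw [one_div]
    exact inv_anti₀ two_pos hM
  rcases lt_or_gt_of_ne hi with h | h
  · obtain ⟨d, rfl⟩ := Nat.exists_eq_add_of_le h.le
    rw [tsum_backward hM0]
    exact backwardCorr_lt (inv_pos.mpr hM0) (by omega)
  · obtain ⟨s, rfl⟩ := Nat.exists_eq_add_of_le h.le
    rw [tsum_forward hM0]
    exact forwardCorr_lt_zero (inv_pos.mpr hM0) hx (by omega)

theorem dualCert_single_nonneg (hα0 : 0 < α0) (hM : 2 ≤ M) (hb : 0 < b)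
    (hΛ : lpSpec (1 / (2 * α0)) M (11 / 60) b 5 Λ) (n j : ℕ) :
    0 ≤ dualCert M α0 b Λ n (lp.single 1 j 1) := by
  have hM0 : 0 < M := by linarith
  rcases j with _ | i
  · exact (dualCert_single_zero hα0 hM hb hΛ n).1
  · rw [dualCert_single_succ hα0 hM0 hb hΛ]
    exact mul_nonneg (by positivity) (tsum_corr_nonneg hM0 n i)

theorem dualCert_single_self (hα0 : 0 < α0) (hM : 0 < M) (hb : b = forwardCorr M⁻¹ 0)
    (hΛ : lpSpec (1 / (2 * α0)) M (11 / 60) b 5 Λ) (n : ℕ) :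
    dualCert M α0 b Λ n (lp.single 1 (n + 1) 1) = n + 2 := by
  have hb0 : 0 < b := hb ▸ forwardCorr_zero_pos (inv_pos.mpr hM)
  have h := tsum_forward hM n 0
  rw [add_zero, ← hb] at h
  rw [dualCert_single_succ hα0 hM hb0 hΛ, h]
  field_simp

theorem dualCert_single_lt (hα0 : 0 < α0) (hM : 2 ≤ M) (hb : b = forwardCorr M⁻¹ 0)
    (hΛ : lpSpec (1 / (2 * α0)) M (11 / 60) b 5 Λ) {n j : ℕ} (hj : j ≠ n + 1) :
    dualCert M α0 b Λ n (lp.single 1 j 1) < j + 1 := by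
  have hM0 : 0 < M := by linarith
  have hb0 : 0 < b := hb ▸ forwardCorr_zero_pos (inv_pos.mpr hM0)
  rcases j with _ | i
  · simpa using (dualCert_single_zero hα0 hM hb0 hΛ n).2
  · have h := tsum_corr_lt hM (n := n) (i := i) (by omega)
    rw [← hb] at h
    rw [dualCert_single_succ hα0 hM0 hb0 hΛ]
    calc _ < ((i : ℝ) + 2) / b * b := by gcongr
      _ = ((i + 1 : ℕ) : ℝ) + 1 := by
        push_cast
        field_simp
        ring

theorem dualCert_single_le (hα0 : 0 < α0) (hM : 2 ≤ M) (hb : b = forwardCorr M⁻¹ 0)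
    (hΛ : lpSpec (1 / (2 * α0)) M (11 / 60) b 5 Λ) (n j : ℕ) :
    dualCert M α0 b Λ n (lp.single 1 j 1) ≤ j + 1 := by
  rcases eq_or_ne j (n + 1) with rfl | hj
  · rw [dualCert_single_self hα0 (by linarith) hb hΛ]
    push_cast
    linarith
  · exact (dualCert_single_lt hα0 hM hb hΛ hj).le

theorem dualCert_useq (hα0 : 0 < α0) (hM : 0 < M) (hb : b = forwardCorr M⁻¹ 0)
    (hΛ : lpSpec (1 / (2 * α0)) M (11 / 60) b 5 Λ) (n : ℕ) :
    dualCert M α0 b Λ n (useq b n) = b := by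
  rw [useq, map_smul, dualCert_single_self hα0 hM hb hΛ, smul_eq_mul]
  field_simp

theorem fidelity_expansion (n : ℕ) (v : lp (fun _ : ℕ => ℝ) 1) :
    α0 * M ^ n * ‖Λ (lp.single 1 0 1) - Λ ((∑ j ∈ Finset.range n, useq b j) + v)‖ ^ 2 =
      α0 * M ^ n *
        ‖Λ (lp.single 1 0 1) - Λ ((∑ j ∈ Finset.range n, useq b j) + useq b n)‖ ^ 2 -
      dualCert M α0 b Λ n (v - useq b n) + α0 * M ^ n * ‖Λ (v - useq b n)‖ ^ 2 := by
  have h : Λ (lp.single 1 0 1) - Λ ((∑ j ∈ Finset.range n, useq b j) + v) =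
      (Λ (lp.single 1 0 1) - Λ ((∑ j ∈ Finset.range n, useq b j) + useq b n)) -
        Λ (v - useq b n) := by
    simp only [map_add, map_sub]
    abel
  rw [h, norm_sub_sq_real, dualCert_apply, Finset.sum_range_succ]
  ring

theorem toReal_Jfun (hα0 : 0 ≤ α0) (hM : 0 ≤ M) (n : ℕ) {v : lp (fun _ : ℕ => ℝ) 1}
    (hv : Rl1 v ≠ ⊤) :
    (Jfun α0 M b Λ n v).toReal =
      α0 * M ^ n * ‖Λ (lp.single 1 0 1) - Λ ((∑ j ∈ Finset.range n, useq b j) + v)‖ ^ 2 +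
        (Rl1 v).toReal := by
  rw [Jfun, ENNReal.toReal_add ENNReal.ofReal_ne_top hv, ENNReal.toReal_ofReal (by positivity)]

theorem Jfun_ne_top {n : ℕ} {v : lp (fun _ : ℕ => ℝ) 1} :
    Jfun α0 M b Λ n v ≠ ⊤ ↔ Rl1 v ≠ ⊤ := by
  simp [Jfun]

theorem Rl1_useq_ne_top (hb : 0 < b) (n : ℕ) : Rl1 (useq b n) ≠ ⊤ := by
  rw [Rl1_useq hb]
  exact ENNReal.ofReal_ne_top

theorem toReal_Jfun_sub (hα0 : 0 < α0) (hM : 2 ≤ M) (hb : b = forwardCorr M⁻¹ 0)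
    (hΛ : lpSpec (1 / (2 * α0)) M (11 / 60) b 5 Λ) (n : ℕ) {v : lp (fun _ : ℕ => ℝ) 1}
    (hv : Rl1 v ≠ ⊤) :
    (Jfun α0 M b Λ n v).toReal - (Jfun α0 M b Λ n (useq b n)).toReal =
      α0 * M ^ n * ‖Λ (v - useq b n)‖ ^ 2 +
        ((Rl1 v).toReal - dualCert M α0 b Λ n v) := by
  have hM0 : 0 < M := by linarith
  have hb0 : 0 < b := hb ▸ forwardCorr_zero_pos (inv_pos.mpr hM0)
  rw [toReal_Jfun hα0.le hM0.le n hv, toReal_Jfun hα0.le hM0.le n (Rl1_useq_ne_top hb0 n),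
    fidelity_expansion, map_sub, dualCert_useq hα0 hM0 hb hΛ, Rl1_useq hb0,
    ENNReal.toReal_ofReal hb0.le]
  ring

theorem Jfun_useq_le (hα0 : 0 < α0) (hM : 2 ≤ M) (hb : b = forwardCorr M⁻¹ 0)
    (hΛ : lpSpec (1 / (2 * α0)) M (11 / 60) b 5 Λ) (n : ℕ) (v : lp (fun _ : ℕ => ℝ) 1) :
    Jfun α0 M b Λ n (useq b n) ≤ Jfun α0 M b Λ n v := by
  have hM0 : 0 < M := by linarith
  have hb0 : 0 < b := hb ▸ forwardCorr_zero_pos (inv_pos.mpr hM0)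
  by_cases hv : Rl1 v = ⊤
  · simp [Jfun, hv]
  · rw [← ENNReal.toReal_le_toReal (Jfun_ne_top.mpr (Rl1_useq_ne_top hb0 n)) (Jfun_ne_top.mpr hv),
      ← sub_nonneg, toReal_Jfun_sub hα0 hM hb hΛ n hv]
    have := clm_le_toReal_Rl1 (dualCert_single_nonneg hα0 hM hb0 hΛ n)
      (dualCert_single_le hα0 hM hb hΛ n) hv
    have h2 : 0 ≤ α0 * M ^ n * ‖Λ (v - useq b n)‖ ^ 2 := by positivity
    linarith

theorem eq_useq_of_Jfun_le (hα0 : 0 < α0) (hM : 2 ≤ M) (hb : b = forwardCorr M⁻¹ 0)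
    (hΛ : lpSpec (1 / (2 * α0)) M (11 / 60) b 5 Λ) {n : ℕ} {v : lp (fun _ : ℕ => ℝ) 1}
    (hle : Jfun α0 M b Λ n v ≤ Jfun α0 M b Λ n (useq b n)) : v = useq b n := by
  have hM0 : 0 < M := by linarith
  have hb0 : 0 < b := hb ▸ forwardCorr_zero_pos (inv_pos.mpr hM0)
  have hu : Jfun α0 M b Λ n (useq b n) ≠ ⊤ := Jfun_ne_top.mpr (Rl1_useq_ne_top hb0 n)
  have hv : Rl1 v ≠ ⊤ := Jfun_ne_top.mp (ne_top_of_le_ne_top hu hle)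
  have hsub := toReal_Jfun_sub hα0 hM hb hΛ n hv
  have hreal := ENNReal.toReal_mono hu hle
  have hR := clm_le_toReal_Rl1 (dualCert_single_nonneg hα0 hM hb0 hΛ n)
    (dualCert_single_le hα0 hM hb hΛ n) hv
  have hnonneg : 0 ≤ α0 * M ^ n * ‖Λ (v - useq b n)‖ ^ 2 := by positivity
  have hcoord : ∀ j, j ≠ n + 1 → v j = 0 := fun j hj =>
    coord_eq_zero_of_toReal_Rl1_le (dualCert_single_nonneg hα0 hM hb0 hΛ n)
      (dualCert_single_le hα0 hM hb hΛ n) hv (by linarith)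
      (dualCert_single_lt hα0 hM hb hΛ hj)
  have hker : Λ (v - useq b n) = 0 := by
    have h0 : α0 * M ^ n * ‖Λ (v - useq b n)‖ ^ 2 = 0 := by linarith
    simpa [hα0.ne', hM0.ne'] using h0
  have hsingle : v - useq b n =
      (v (n + 1) - b / (n + 2)) • (lp.single 1 (n + 1) 1 : lp (fun _ : ℕ => ℝ) 1) := by
    have hv1 : v = v (n + 1) • (lp.single 1 (n + 1) 1 : lp (fun _ : ℕ => ℝ) 1) := by
      ext j
      rcases eq_or_ne j (n + 1) with rfl | hj
      · simp
      · simp [hcoord j hj, hj]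
    rw [sub_smul, ← hv1, useq]
  have hcert : dualCert M α0 b Λ n (v - useq b n) = 0 := by
    rw [dualCert_apply, hker, inner_zero_right, mul_zero]
  rw [hsingle, map_smul, dualCert_single_self hα0 hM0 hb hΛ, smul_eq_mul] at hcert
  have hc : v (n + 1) - b / (n + 2) = 0 :=
    (mul_eq_zero.mp hcert).resolve_right (by positivity)
  rw [hc, zero_smul] at hsingle
  exact sub_eq_zero.mp hsingle

end Operator

theorem norm_sum_useq {b : ℝ} (hb : 0 ≤ b) (n : ℕ) :
    ‖∑ j ∈ Finset.range n, useq b j‖ = ∑ j ∈ Finset.range n, b / ((j : ℝ) + 2) := by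
  have h := lp.norm_sum_single (p := 1) (E := fun _ : ℕ => ℝ) (by simp)
    (fun i => b / ((i : ℝ) + 1)) ((Finset.range n).map (addRightEmbedding 1))
  simp only [Finset.sum_map, addRightEmbedding_apply, ENNReal.toReal_one, Real.rpow_one] at h
  have hu : ∀ j : ℕ, useq b j = lp.single 1 (j + 1) (b / (((j + 1 : ℕ) : ℝ) + 1)) := fun j => by
    rw [useq, ← lp.single_smul, smul_eq_mul, mul_one]
    congr 2
    push_cast
    ring
  rw [Finset.sum_congr rfl fun j _ => hu j, h]
  refine Finset.sum_congr rfl fun j _ => ?_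
  rw [Real.norm_of_nonneg (by positivity)]
  push_cast
  ring

theorem tendsto_norm_sum_useq {b : ℝ} (hb : 0 < b) :
    Tendsto (fun n : ℕ => ‖∑ j ∈ Finset.range (n + 1), useq b j‖) atTop atTop := by
  simp only [norm_sum_useq hb.le]
  have hns : ¬ Summable fun j : ℕ => b / ((j : ℝ) + 2) := by
    intro h
    refine Real.not_summable_one_div_natCast ((summable_nat_add_iff 2).mp ?_)
    refine (h.mul_left b⁻¹).congr fun j => ?_
    push_cast
    field_simp
  exact ((not_summable_iff_tendsto_nat_atTop_of_nonneg fun j => by positivity).mp hns).comp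
    (tendsto_add_atTop_nat 1)

/-- Theorem 4.2, first counterexample in sequence spaces.
For every `M ≥ 2`, `α₀ > 0` and `k = 5` there are `c₀, b > 0` and `0 < δ < 1/k` such
that for `Λ̃ = Λ e₁` the multiscale sequence coincides with `σ_n = ∑_{j=0}^n u_j`,
`u_j = (b/(j+2)) e_{j+2}`: each `u_n` is the unique minimizer of
`λ_n‖Λ e₁ − Λ(σ_{n−1}+u)‖² + R(u)` over `ℓ¹`; moreover `‖σ_n‖_{ℓ¹} → +∞`. -/
theorem statement14 (M α0 : ℝ) (hM : 2 ≤ M) (hα0 : 0 < α0) (k : ℕ) (hk : k = 5) :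
    ∃ c0 b δ : ℝ, 0 < c0 ∧ 0 < b ∧ 0 < δ ∧ δ < 1 / k ∧
      ∀ Λ : lp (fun _ : ℕ => ℝ) 1 →L[ℝ] lp (fun _ : ℕ => ℝ) 2,
        lpSpec c0 M δ b k Λ →
        (∀ n : ℕ,
          (∀ v : lp (fun _ : ℕ => ℝ) 1, Jfun α0 M b Λ n (useq b n) ≤ Jfun α0 M b Λ n v) ∧
          (∀ v : lp (fun _ : ℕ => ℝ) 1,
            (∀ v' : lp (fun _ : ℕ => ℝ) 1, Jfun α0 M b Λ n v ≤ Jfun α0 M b Λ n v') →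
            v = useq b n)) ∧
        Tendsto (fun n : ℕ => ‖∑ j ∈ Finset.range (n + 1), useq b j‖) atTop atTop := by
  subst hk
  have hM0 : 0 < M := by linarith
  have hb : 0 < forwardCorr M⁻¹ 0 := forwardCorr_zero_pos (inv_pos.mpr hM0)
  refine ⟨1 / (2 * α0), forwardCorr M⁻¹ 0, 11 / 60, by positivity, hb, by norm_num, by norm_num,
    fun Λ hΛ => ⟨fun n => ⟨Jfun_useq_le hα0 hM rfl hΛ n, fun v hv => ?_⟩,
      tendsto_norm_sum_useq hb⟩⟩
  exact eq_useq_of_Jfun_le hα0 hM rfl hΛ (hv _)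
end
end
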